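/- Let X and Y be topological spaces, let f : X → Y be continuous, let x ∈ X, and let n ≥ 1. Suppose that the map π₁(X, x) → π₁(Y, f(x)) induced by f and the map π₁(C(Sⁿ, X), const_x) → π₁(C(Sⁿ, Y), const_{f(x)}) induced by postcomposition with f are both bijective. Then the induced map π_{n+1}(X, x) → π_{n+1}(Y, f(x)) is bijective. -/

import Mathlib

open Topology Topology.Homotopy

/-- The map on homotopy groups induced by a continuous map, given by postcomposition of
(generalized) loops. -/
def HomotopyGroup.map {X Y : Type*} [TopologicalSpace X] [TopologicalSpace Y]
    (f : C(X, Y)) (x : X) (N : Type*) :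
    HomotopyGroup N X x → HomotopyGroup N Y (f x) :=
  Quotient.map
    (fun p => (⟨f.comp p.1, fun y hy => congrArg f (p.2 y hy)⟩ : GenLoop N Y (f x)))
    (fun _ _ h => Nonempty.map (fun H => H.compContinuousMap f) h)

/-- The postcomposition map `C(Sⁿ, X) → C(Sⁿ, Y)` induced by `f : C(X, Y)`, as a
continuous map for the compact-open topologies. -/
noncomputable def spherePostcomp {X Y : Type*} [TopologicalSpace X] [TopologicalSpace Y]
    (f : C(X, Y)) (n : ℕ) :
    C(C(↥(Metric.sphere (0 : EuclideanSpace ℝ (Fin (n + 1))) 1), X),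
      C(↥(Metric.sphere (0 : EuclideanSpace ℝ (Fin (n + 1))) 1), Y)) :=
  ⟨fun g => f.comp g, ContinuousMap.continuous_postcomp f⟩

open scoped unitInterval

section CubeToSphere

/-- A continuous surjection from the cube that identifies exactly the boundary points. -/
structure IsBoundaryCollapse {N S : Type*} [TopologicalSpace S] (q : (I^N) → S) : Prop where
  continuous : Continuous q
  surjective : Function.Surjective q
  eq_of_mem : ∀ y ∈ Cube.boundary N, ∀ y' ∈ Cube.boundary N, q y = q y'
  eq_or_mem : ∀ y y', q y = q y' → y = y' ∨ y ∈ Cube.boundary N ∧ y' ∈ Cube.boundary N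

theorem Topology.IsOpenEmbedding.continuous_extend_infty {V K : Type*} [TopologicalSpace V]
    [TopologicalSpace K] [T2Space K] {e : V → K} (he : IsOpenEmbedding e) :
    Continuous (Function.extend e ((↑) : V → OnePoint V) fun _ => OnePoint.infty) := by
  set ψ := Function.extend e ((↑) : V → OnePoint V) fun _ => OnePoint.infty
  have hψ : ∀ v, ψ (e v) = v := fun v => he.injective.extend_apply _ _ v
  have hψ' : ∀ k, k ∉ Set.range e → ψ k = OnePoint.infty := fun k hk =>
    Function.extend_apply' _ _ _ hk
  refine continuous_def.2 fun s hs => ?_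
  by_cases h : OnePoint.infty ∈ s
  · have hc := ((OnePoint.isOpen_iff_of_mem' h).1 hs).1
    have : ψ ⁻¹' s = (e '' ((↑) ⁻¹' s : Set V)ᶜ)ᶜ := by
      ext k
      by_cases hk : k ∈ Set.range e
      · obtain ⟨v, rfl⟩ := hk
        simp [hψ, he.injective.eq_iff]
      · simp only [Set.mem_preimage, hψ' k hk, h, true_iff]
        exact fun h' => hk (Set.image_subset_range _ _ h')
    rw [this]
    exact (hc.image he.continuous).isClosed.isOpen_compl
  · have ho := (OnePoint.isOpen_iff_of_notMem h).1 hs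
    have : ψ ⁻¹' s = e '' ((↑) ⁻¹' s : Set V) := by
      ext k
      by_cases hk : k ∈ Set.range e
      · obtain ⟨v, rfl⟩ := hk
        simp [hψ, he.injective.eq_iff]
      · simp only [Set.mem_preimage, hψ' k hk, h, false_iff]
        exact fun h' => hk (Set.image_subset_range _ _ h')
    rw [this]
    exact he.isOpenMap _ ho

theorem Cube.isClosed_boundary (N : Type*) [Finite N] : IsClosed (Cube.boundary N) := by
  have : Cube.boundary N = ⋃ i, {y : I^N | y i = 0 ∨ y i = 1} := by
    ext y; simp [Cube.boundary]
  rw [this]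
  refine isClosed_iUnion_of_finite fun i => ?_
  exact (isClosed_eq (continuous_apply i) continuous_const).union
    (isClosed_eq (continuous_apply i) continuous_const)

theorem Cube.range_piMap_sigmoid (N : Type*) :
    Set.range (Pi.map fun _ : N => unitInterval.sigmoid) = (Cube.boundary N)ᶜ := by
  rw [Set.range_piMap]
  ext y
  simp only [unitInterval.range_sigmoid, Set.mem_pi, Set.mem_univ, true_implies, Set.mem_Ioo,
    Cube.boundary, Set.mem_compl_iff, Set.mem_ofPred_eq, not_exists, not_or,
    unitInterval.pos_iff_ne_zero, unitInterval.lt_one_iff_ne_one]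

theorem exists_isBoundaryCollapse_sphere (n : ℕ) (hn : 1 ≤ n) :
    ∃ q : (I^(Fin n)) → Metric.sphere (0 : EuclideanSpace ℝ (Fin (n + 1))) 1,
      IsBoundaryCollapse q := by
  have he : IsOpenEmbedding (Pi.map fun _ : Fin n => unitInterval.sigmoid) :=
    ⟨.piMap fun _ => isEmbedding_sigmoid, by
      rw [Cube.range_piMap_sigmoid]; exact (Cube.isClosed_boundary _).isOpen_compl⟩
  have hr := Cube.range_piMap_sigmoid (Fin n)
  set e := Pi.map fun _ : Fin n => unitInterval.sigmoid
  let φ : OnePoint (Fin n → ℝ) ≃ₜ Metric.sphere (0 : EuclideanSpace ℝ (Fin (n + 1))) 1 :=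
    onePointEquivSphereOfFinrankEq (by simp)
  have hin : ∀ v, Function.extend e ((↑) : _ → OnePoint (Fin n → ℝ)) (fun _ => OnePoint.infty)
      (e v) = v := fun v => he.injective.extend_apply _ _ v
  have hout : ∀ y ∈ Cube.boundary (Fin n), Function.extend e
      ((↑) : _ → OnePoint (Fin n → ℝ)) (fun _ => OnePoint.infty) y = OnePoint.infty :=
    fun y hy => Function.extend_apply' _ _ _ fun h => by
      have : y ∈ Set.range e := h
      rw [hr] at this
      exact this hy
  have hcases : ∀ y, y ∈ Cube.boundary (Fin n) ∨ ∃ v, e v = y := fun y => by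
    by_cases hy : y ∈ Cube.boundary (Fin n)
    · exact .inl hy
    · exact .inr (by rw [← Set.mem_compl_iff, ← hr] at hy; exact hy)
  refine ⟨fun y => φ (Function.extend e (↑) (fun _ => OnePoint.infty) y),
    φ.continuous.comp he.continuous_extend_infty, φ.surjective.comp fun z => ?_,
    fun y hy y' hy' => by simp only [hout y hy, hout y' hy'], fun y y' h => ?_⟩
  · induction z using OnePoint.rec with
    | infty => exact ⟨fun _ => 0, hout _ ⟨⟨0, hn⟩, .inl rfl⟩⟩
    | coe v => exact ⟨e v, hin v⟩
  · replace h := φ.injective h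
    rcases hcases y with hy | ⟨v, rfl⟩ <;> rcases hcases y' with hy' | ⟨v', rfl⟩
    · exact .inr ⟨hy, hy'⟩
    · rw [hout y hy, hin] at h
      exact (OnePoint.infty_ne_coe _ h).elim
    · rw [hout y' hy', hin] at h
      exact (OnePoint.coe_ne_infty _ h).elim
    · rw [hin, hin, OnePoint.coe_eq_coe] at h
      exact .inl (congrArg e h)

/-- Families of maps on the cube that are constant on its boundary descend along a collapse. -/
theorem IsBoundaryCollapse.exists_lift {N S T X : Type*} [TopologicalSpace S] [T2Space S]
    [TopologicalSpace T] [CompactSpace T] [T2Space T] [TopologicalSpace X] {q : (I^N) → S}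
    (hq : IsBoundaryCollapse q) (F : T → (I^N) → X) (hF : Continuous ↿F)
    (hb : ∀ t, ∀ y ∈ Cube.boundary N, ∀ y' ∈ Cube.boundary N, F t y = F t y') :
    ∃ G : C(T, C(S, X)), ∀ t y, G t (q y) = F t y := by
  have hQ : IsQuotientMap (Prod.map id q : T × (I^N) → T × S) := by
    have hc : Continuous (Prod.map id q : T × (I^N) → T × S) :=
      continuous_id.prodMap hq.continuous
    exact hc.isClosedMap.isQuotientMap hc (Function.surjective_id.prodMap hq.surjective)
  have key : ∀ t y, F t (Function.surjInv hq.surjective (q y)) = F t y := fun t y => by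
    rcases hq.eq_or_mem _ _ (Function.surjInv_eq hq.surjective (q y)) with h | ⟨h, h'⟩
    · rw [h]
    · exact hb t _ h _ h'
  have hG : Continuous fun z : T × S => F z.1 (Function.surjInv hq.surjective z.2) := by
    rw [hQ.continuous_iff]
    refine hF.congr fun z => ?_
    exact (key z.1 z.2).symm
  exact ⟨ContinuousMap.curry ⟨_, hG⟩, key⟩

end CubeToSphere

section Collar

variable {n : ℕ}

/-- Magnification of the cube about its centre by the factor `1 + t`, clamped to the cube. -/
noncomputable def Cube.magnify (t : I) (y : I^(Fin n)) : I^(Fin n) :=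
  fun i => Set.projIcc 0 1 zero_le_one ((1 + t) * y i - t / 2 : ℝ)

/-- The signed depth of a point of the cube in the collar that is squashed onto the boundary by
`Cube.magnify t`. -/
noncomputable def Cube.collarDepth (t : I) (y : I^(Fin n)) : ℝ :=
  ‖fun i => (1 + t : ℝ) * (2 * y i - 1)‖ - 1

theorem Cube.continuous_magnify :
    Continuous fun z : I × (I^(Fin n)) => Cube.magnify z.1 z.2 := by
  unfold Cube.magnify
  refine continuous_pi fun i => continuous_projIcc.comp ?_
  fun_prop

theorem Cube.continuous_collarDepth :
    Continuous fun z : I × (I^(Fin n)) => Cube.collarDepth z.1 z.2 := by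
  unfold Cube.collarDepth
  fun_prop

theorem Cube.magnify_zero (y : I^(Fin n)) : Cube.magnify 0 y = y := by
  ext i; simp [Cube.magnify]

theorem Cube.abs_two_mul_sub_one_le (s : I) : |2 * (s : ℝ) - 1| ≤ 1 := by
  rw [abs_le]; constructor <;> linarith [s.2.1, s.2.2]

theorem Cube.collarDepth_le (t : I) (y : I^(Fin n)) : Cube.collarDepth t y ≤ t := by
  have ht : (0 : ℝ) ≤ 1 + t := by linarith [t.2.1]
  rw [Cube.collarDepth, sub_le_iff_le_add', pi_norm_le_iff_of_nonneg ht]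
  intro i
  rw [Real.norm_eq_abs, abs_mul, abs_of_nonneg ht]
  exact mul_le_of_le_one_right ht (Cube.abs_two_mul_sub_one_le _)

theorem Cube.collarDepth_of_mem_boundary (t : I) {y : I^(Fin n)}
    (hy : y ∈ Cube.boundary (Fin n)) : Cube.collarDepth t y = t := by
  refine (Cube.collarDepth_le t y).antisymm ?_
  obtain ⟨i, hi⟩ := hy
  have ht : (0 : ℝ) ≤ 1 + t := by linarith [t.2.1]
  have h := norm_le_pi_norm (fun i => (1 + t : ℝ) * (2 * y i - 1)) i
  have h1 : |2 * (y i : ℝ) - 1| = 1 := by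
    rcases hi with hi | hi <;> rw [hi] <;> norm_num
  rw [Real.norm_eq_abs, abs_mul, abs_of_nonneg ht, h1] at h
  rw [Cube.collarDepth]
  linarith

theorem Cube.magnify_mem_boundary {t : I} {y : I^(Fin n)} (h : 0 ≤ Cube.collarDepth t y) :
    Cube.magnify t y ∈ Cube.boundary (Fin n) := by
  by_contra hm
  refine h.not_gt ?_
  rw [Cube.collarDepth, sub_neg, pi_norm_lt_iff one_pos]
  intro i
  rw [Real.norm_eq_abs, abs_lt]
  constructor
  · by_contra hi
    exact hm ⟨i, .inl (Set.projIcc_of_le_left _ (by linarith))⟩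
  · by_contra hi
    exact hm ⟨i, .inr (Set.projIcc_of_right_le _ (by linarith))⟩

theorem Cube.magnify_mem_boundary_of_mem (t : I) {y : I^(Fin n)}
    (hy : y ∈ Cube.boundary (Fin n)) : Cube.magnify t y ∈ Cube.boundary (Fin n) :=
  Cube.magnify_mem_boundary (by rw [Cube.collarDepth_of_mem_boundary t hy]; exact t.2.1)

theorem Cube.exists_collar_function (n : ℕ) : ∃ r : (I^(Fin n)) → I, Continuous r ∧
    (∀ y, Cube.magnify 1 y ∉ Cube.boundary (Fin n) → r y = 0) ∧
    ∀ y ∈ Cube.boundary (Fin n), r y = 1 := by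
  have hd : Continuous fun y : I^(Fin n) => Cube.collarDepth 1 y :=
    Cube.continuous_collarDepth.comp (f := fun y : I^(Fin n) => ((1 : I), y))
      (Continuous.prodMk_right 1)
  refine ⟨fun y => Set.projIcc 0 1 zero_le_one (Cube.collarDepth 1 y), continuous_projIcc.comp hd,
    fun y hy => Set.projIcc_of_le_left _ ?_, fun y hy => Set.projIcc_of_right_le _ ?_⟩
  · exact not_lt.1 fun h => hy (Cube.magnify_mem_boundary h.le)
  · rw [Cube.collarDepth_of_mem_boundary 1 hy, Set.Icc.coe_one]

theorem Cube.mem_boundary_succ {w : I^(Fin (n + 1))} :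
    w ∈ Cube.boundary (Fin (n + 1)) ↔
      (w 0 = 0 ∨ w 0 = 1) ∨ Fin.tail w ∈ Cube.boundary (Fin n) := by
  simp [Cube.boundary, Fin.exists_fin_succ, Fin.tail]

theorem Cube.cons_mem_boundary {s : I} {y : I^(Fin n)} :
    (Fin.cons s y : I^(Fin (n + 1))) ∈ Cube.boundary (Fin (n + 1)) ↔
      (s = 0 ∨ s = 1) ∨ y ∈ Cube.boundary (Fin n) := by
  simp [Cube.mem_boundary_succ]

end Collar

section GenLoopHomotopy

theorem GenLoop.homotopic_iff_exists {N X : Type*} [TopologicalSpace X] {x : X}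
    {p q : GenLoop N X x} :
    GenLoop.Homotopic p q ↔ ∃ F : I → (I^N) → X, Continuous ↿F ∧ (∀ y, F 0 y = p y) ∧
      (∀ y, F 1 y = q y) ∧ ∀ t, ∀ y ∈ Cube.boundary N, F t y = x := by
  constructor
  · rintro ⟨H⟩
    refine ⟨fun t y => H (t, y), H.continuous, H.apply_zero, H.apply_one, fun t y hy => ?_⟩
    exact (H.eq_fst t hy).trans (p.2 y hy)
  · rintro ⟨F, hF, h0, h1, hb⟩
    exact ⟨⟨⟨⟨↿F, hF⟩, h0, h1⟩, fun t y hy => (hb t y hy).trans (p.2 y hy).symm⟩⟩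

variable {X : Type*} [TopologicalSpace X] {x : X} {n : ℕ}

theorem GenLoop.exists_homotopic_magnify (a : GenLoop (Fin (n + 1)) X x) :
    ∃ a' : GenLoop (Fin (n + 1)) X x, GenLoop.Homotopic a a' ∧ ∀ w, a' w =
      a (Fin.cons (Set.projIcc 0 1 zero_le_one (2 * w 0 : ℝ)) (Cube.magnify 1 (Fin.tail w))) := by
  let F : I → (I^(Fin (n + 1))) → X := fun t w =>
    a (Fin.cons (Set.projIcc 0 1 zero_le_one ((1 + t) * w 0 : ℝ)) (Cube.magnify t (Fin.tail w)))
  have hF : Continuous ↿F := by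
    refine a.1.continuous.comp (Continuous.finCons (continuous_projIcc.comp (by fun_prop)) ?_)
    exact Cube.continuous_magnify.comp
      (f := fun z : I × (I^(Fin (n + 1))) => (z.1, (Fin.tail z.2 : I^(Fin n))))
      (continuous_fst.prodMk (continuous_pi fun i => by simp only [Fin.tail]; fun_prop))
  have hb : ∀ t, ∀ w ∈ Cube.boundary (Fin (n + 1)), F t w = x := fun t w hw => by
    refine a.2 _ (Cube.cons_mem_boundary.2 ?_)
    rcases Cube.mem_boundary_succ.1 hw with (h | h) | h
    · exact .inl (.inl (by simp [h]))
    · refine .inl (.inr (Set.projIcc_of_right_le _ ?_))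
      simp [h, t.2.1]
    · exact .inr (Cube.magnify_mem_boundary_of_mem t h)
  refine ⟨⟨⟨F 1, hF.comp (Continuous.prodMk_right 1)⟩, hb 1⟩,
    GenLoop.homotopic_iff_exists.2 ⟨F, hF, fun w => ?_, fun w => rfl, hb⟩, fun w => ?_⟩
  · simp [F, Cube.magnify_zero]
  · change F 1 w = _
    simp only [F, Set.Icc.coe_one]
    norm_num

/-- A family of maps on the cube, each constant on the boundary, whose restriction to the boundary
is allowed to move during the homotopy can be made into a homotopy relative to the boundary. -/
theorem GenLoop.homotopic_of_free (hn : 1 ≤ n) {a a' : GenLoop (Fin (n + 1)) X x}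
    (H : I → I → (I^(Fin n)) → X) (hH : Continuous fun z : I × I × (I^(Fin n)) => H z.1 z.2.1 z.2.2)
    (h0 : ∀ s y, H 0 s y = a (Fin.cons s y)) (h1 : ∀ s y, H 1 s y = a' (Fin.cons s y))
    (hs0 : ∀ t y, H t 0 y = x) (hs1 : ∀ t y, H t 1 y = x)
    (hb : ∀ t s, ∀ y ∈ Cube.boundary (Fin n), ∀ y' ∈ Cube.boundary (Fin n), H t s y = H t s y') :
    GenLoop.Homotopic a a' := by
  obtain ⟨b, hab, hbw⟩ := GenLoop.exists_homotopic_magnify a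
  obtain ⟨b', hab', hbw'⟩ := GenLoop.exists_homotopic_magnify a'
  refine hab.trans (GenLoop.Homotopic.trans ?_ hab'.symm)
  obtain ⟨pr, hprc, hpr0, hpr1, hpr⟩ : ∃ pr : ℝ → I, Continuous pr ∧ (∀ u ≤ 0, pr u = 0) ∧
      (∀ u, 1 ≤ u → pr u = 1) ∧ pr = Set.projIcc 0 1 zero_le_one :=
    ⟨_, continuous_projIcc, fun u hu => Set.projIcc_of_le_left _ hu,
      fun u hu => Set.projIcc_of_right_le _ hu, rfl⟩
  rw [← hpr] at hbw hbw'
  obtain ⟨r, hrc, hr, hr1⟩ := Cube.exists_collar_function n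
  have hc0 : (0 : I^(Fin n)) ∈ Cube.boundary (Fin n) := ⟨⟨0, hn⟩, .inl rfl⟩
  have htail : Continuous fun w : I^(Fin (n + 1)) => (Fin.tail w : I^(Fin n)) :=
    continuous_pi fun i => by simp only [Fin.tail]; fun_prop
  have hmc : Continuous fun y : I^(Fin n) => Cube.magnify 1 y :=
    Cube.continuous_magnify.comp (Continuous.prodMk_right 1)
  let K : I → (I^(Fin (n + 1))) → X := fun t w =>
    if (w 0 : ℝ) ≤ 1 / 2 then H t (pr (2 * w 0) * σ (r (Fin.tail w))) (Cube.magnify 1 (Fin.tail w))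
    else H t (pr (2 - 2 * w 0) * σ (r (Fin.tail w))) 0
  have hend : ∀ (t : I) (c : GenLoop (Fin (n + 1)) X x), (∀ s y, H t s y = c (Fin.cons s y)) →
      ∀ w, K t w = c (Fin.cons (pr (2 * w 0)) (Cube.magnify 1 (Fin.tail w))) := by
    intro t c hc w
    simp only [K]
    split_ifs with h
    · rw [hc]
      by_cases hm : Cube.magnify 1 (Fin.tail w) ∈ Cube.boundary (Fin n)
      · rw [GenLoop.boundary c _ (Cube.cons_mem_boundary.2 (.inr hm)),
          GenLoop.boundary c _ (Cube.cons_mem_boundary.2 (.inr hm))]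
      · rw [hr _ hm]; simp
    · rw [hc, GenLoop.boundary c _ (Cube.cons_mem_boundary.2 (.inr hc0)),
        GenLoop.boundary c _ (Cube.cons_mem_boundary.2 (.inl (.inr (hpr1 _ (by linarith)))))]
  refine GenLoop.homotopic_iff_exists.2 ⟨K, ?_, fun w => ?_, fun w => ?_, fun t w hw => ?_⟩
  · refine Continuous.if_le (f' := fun z : I × (I^(Fin (n + 1))) =>
        H z.1 (pr (2 * z.2 0) * σ (r (Fin.tail z.2))) (Cube.magnify 1 (Fin.tail z.2)))
      (g' := fun z => H z.1 (pr (2 - 2 * z.2 0) * σ (r (Fin.tail z.2))) 0)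
      (f := fun z => (z.2 0 : ℝ)) (g := fun _ => 1 / 2) ?_ ?_ (by fun_prop) (by fun_prop) ?_
    · exact hH.comp (f := fun z : I × (I^(Fin (n + 1))) => (z.1,
        pr (2 * z.2 0) * σ (r (Fin.tail z.2)), Cube.magnify 1 (Fin.tail z.2))) (by fun_prop)
    · exact hH.comp (f := fun z : I × (I^(Fin (n + 1))) => (z.1,
        pr (2 - 2 * z.2 0) * σ (r (Fin.tail z.2)), 0)) (by fun_prop)
    · intro z hz
      have e1 : pr (2 * z.2 0) = 1 := hpr1 _ (by linarith)
      have e2 : pr (2 - 2 * z.2 0) = 1 := hpr1 _ (by linarith)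
      simp only [e1, e2, one_mul]
      by_cases hm : Cube.magnify 1 (Fin.tail z.2) ∈ Cube.boundary (Fin n)
      · exact hb _ _ _ hm _ hc0
      · rw [hr _ hm, unitInterval.symm_zero, hs1, hs1]
  · rw [hend 0 a h0, hbw]
  · rw [hend 1 a' h1, hbw']
  · simp only [K]
    rcases Cube.mem_boundary_succ.1 hw with (h | h) | h
    · rw [h, if_pos (by simp), hpr0 _ (by simp), zero_mul, hs0]
    · rw [h, if_neg (by norm_num), hpr0 _ (by simp), zero_mul, hs0]
    · rw [hr1 _ h, unitInterval.symm_one, mul_zero, mul_zero, hs0, hs0, ite_self]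

/-- Homotopy extension for the boundary of the cube: a null homotopy `Γ` of the values on the
boundary extends to the whole cube. -/
theorem Cube.exists_homotopy_extension {T : Type*} [TopologicalSpace T]
    (b : T → (I^(Fin n)) → X) (hb : Continuous ↿b) (Γ : I → T → X) (hΓ : Continuous ↿Γ)
    (h0 : ∀ s, ∀ y ∈ Cube.boundary (Fin n), b s y = Γ 0 s) :
    ∃ L : I → T → (I^(Fin n)) → X,
      Continuous (fun z : I × T × (I^(Fin n)) => L z.1 z.2.1 z.2.2) ∧
      (∀ s y, L 0 s y = b s y) ∧ (∀ t s, ∀ y ∈ Cube.boundary (Fin n), L t s y = Γ t s) ∧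
      ∀ s, (∀ y, b s y = x) → (∀ t, Γ t s = x) → ∀ t y, L t s y = x := by
  let pr : ℝ → I := Set.projIcc 0 1 zero_le_one
  have hprc : Continuous pr := continuous_projIcc
  have hpr0 : pr 0 = 0 := Set.projIcc_left _
  refine ⟨fun t s y => if Cube.collarDepth t y ≤ 0 then b s (Cube.magnify t y)
    else Γ (pr (Cube.collarDepth t y)) s, ?_, fun s y => ?_, fun t s y hy => ?_,
    fun s h h' t y => ?_⟩
  · have hd : Continuous fun z : I × T × (I^(Fin n)) => Cube.collarDepth z.1 z.2.2 :=
      Cube.continuous_collarDepth.comp (f := fun z : I × T × (I^(Fin n)) => (z.1, z.2.2))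
        (by fun_prop)
    have hm : Continuous fun z : I × T × (I^(Fin n)) => Cube.magnify z.1 z.2.2 :=
      Cube.continuous_magnify.comp (f := fun z : I × T × (I^(Fin n)) => (z.1, z.2.2))
        (by fun_prop)
    refine Continuous.if_le ?_ ?_ hd continuous_const fun z hz => ?_
    · exact hb.comp (f := fun z : I × T × (I^(Fin n)) => (z.2.1, Cube.magnify z.1 z.2.2))
        (by fun_prop)
    · exact hΓ.comp (f := fun z : I × T × (I^(Fin n)) =>
        (pr (Cube.collarDepth z.1 z.2.2), z.2.1)) (by fun_prop)
    · rw [hz, hpr0]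
      exact h0 _ _ (Cube.magnify_mem_boundary hz.ge)
  · beta_reduce
    rw [if_pos (by simpa using Cube.collarDepth_le 0 y), Cube.magnify_zero]
  · simp only [Cube.collarDepth_of_mem_boundary t hy]
    split_ifs with h
    · have ht : t = 0 := Subtype.ext (le_antisymm h t.2.1)
      rw [ht, Cube.magnify_zero, h0 s y hy]
    · rw [show pr t = t from Set.projIcc_val _ t]
  · simp only [h, h', ite_self]

end GenLoopHomotopy

section SphereLoops

variable {X : Type*} [TopologicalSpace X] {x : X} {n : ℕ} {S : Type*} [TopologicalSpace S]

/-- `p` is the loop in the mapping space `C(S, X)` obtained from the generalized loop `a` by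
collapsing the boundary of the last `n` coordinates. -/
def IsSphereLoopOf (q : (I^(Fin n)) → S) (a : GenLoop (Fin (n + 1)) X x)
    (p : GenLoop (Fin 1) C(S, X) (ContinuousMap.const S x)) : Prop :=
  ∀ c y, p c (q y) = a (Fin.cons (c 0) y)

theorem Cube.mem_boundary_fin_one {c : I^(Fin 1)} :
    c ∈ Cube.boundary (Fin 1) ↔ c 0 = 0 ∨ c 0 = 1 := by
  simp [Cube.boundary]

variable {q : (I^(Fin n)) → S}

theorem IsBoundaryCollapse.exists_isSphereLoopOf [T2Space S] (hq : IsBoundaryCollapse q)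
    (a : GenLoop (Fin (n + 1)) X x) : ∃ p, IsSphereLoopOf q a p := by
  obtain ⟨G, hG⟩ := hq.exists_lift (T := I^(Fin 1)) (fun c y => a (Fin.cons (c 0) y))
    (a.1.continuous.comp (Continuous.finCons (by fun_prop) (by fun_prop)))
    fun c y hy y' hy' => by
      rw [GenLoop.boundary a _ (Cube.cons_mem_boundary.2 (.inr hy)),
        GenLoop.boundary a _ (Cube.cons_mem_boundary.2 (.inr hy'))]
  refine ⟨⟨G, fun c hc => ContinuousMap.ext fun z => ?_⟩, hG⟩
  obtain ⟨y, rfl⟩ := hq.surjective z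
  rw [hG]
  exact GenLoop.boundary a _ (Cube.cons_mem_boundary.2 (.inl (Cube.mem_boundary_fin_one.1 hc)))

theorem IsSphereLoopOf.homotopic [T2Space S] (hq : IsBoundaryCollapse q)
    {a a' : GenLoop (Fin (n + 1)) X x}
    {p p' : GenLoop (Fin 1) C(S, X) (ContinuousMap.const S x)}
    (h : IsSphereLoopOf q a p) (h' : IsSphereLoopOf q a' p') (H : GenLoop.Homotopic a a') :
    GenLoop.Homotopic p p' := by
  obtain ⟨F, hF, h0, h1, hb⟩ := GenLoop.homotopic_iff_exists.1 H
  obtain ⟨G, hG⟩ := hq.exists_lift (T := I × (I^(Fin 1)))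
    (fun z y => F z.1 (Fin.cons (z.2 0) y))
    (hF.comp (f := fun z : (I × (I^(Fin 1))) × (I^(Fin n)) =>
        (z.1.1, (Fin.cons (z.1.2 0) z.2 : I^(Fin (n + 1)))))
      (Continuous.prodMk (by fun_prop) (Continuous.finCons (by fun_prop) (by fun_prop))))
    fun z y hy y' hy' => by
      rw [hb _ _ (Cube.cons_mem_boundary.2 (.inr hy)),
        hb _ _ (Cube.cons_mem_boundary.2 (.inr hy'))]
  refine GenLoop.homotopic_iff_exists.2 ⟨fun t c => G (t, c), G.continuous,
    fun c => ContinuousMap.ext fun z => ?_, fun c => ContinuousMap.ext fun z => ?_,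
    fun t c hc => ContinuousMap.ext fun z => ?_⟩ <;> obtain ⟨y, rfl⟩ := hq.surjective z
  · rw [hG, h, h0]
  · rw [hG, h', h1]
  · rw [hG]
    exact hb _ _ (Cube.cons_mem_boundary.2 (.inl (Cube.mem_boundary_fin_one.1 hc)))

theorem IsSphereLoopOf.homotopic_of_homotopic [LocallyCompactSpace S] (hn : 1 ≤ n)
    (hq : IsBoundaryCollapse q) {a a' : GenLoop (Fin (n + 1)) X x}
    {p p' : GenLoop (Fin 1) C(S, X) (ContinuousMap.const S x)}
    (h : IsSphereLoopOf q a p) (h' : IsSphereLoopOf q a' p') (H : GenLoop.Homotopic p p') :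
    GenLoop.Homotopic a a' := by
  obtain ⟨F, hF, h0, h1, hb⟩ := GenLoop.homotopic_iff_exists.1 H
  have hqc := hq.continuous
  refine GenLoop.homotopic_of_free hn (fun t s y => F t (fun _ => s) (q y)) ?_
    (fun s y => by rw [h0, h]) (fun s y => by rw [h1, h'])
    (fun t y => by rw [hb _ _ ⟨0, .inl rfl⟩]; rfl) (fun t y => by rw [hb _ _ ⟨0, .inr rfl⟩]; rfl)
    fun t s y hy y' hy' => by rw [hq.eq_of_mem y hy y' hy']
  exact (ContinuousMap.continuous_uncurry_of_continuous ⟨↿F, hF⟩).comp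
    (f := fun z : I × I × (I^(Fin n)) => ((z.1, fun _ : Fin 1 => z.2.1), q z.2.2)) (by fun_prop)

theorem IsBoundaryCollapse.exists_isSphereLoopOf_homotopic [T2Space S] [LocallyCompactSpace S]
    (hq : IsBoundaryCollapse q) (z₀ : S) (hz₀ : ∀ y ∈ Cube.boundary (Fin n), q y = z₀)
    (p : GenLoop (Fin 1) C(S, X) (ContinuousMap.const S x)) (Γ : I → (I^(Fin 1)) → X)
    (hΓ : Continuous ↿Γ) (h0 : ∀ c, Γ 0 c = p c z₀) (h1 : ∀ c, Γ 1 c = x)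
    (hb : ∀ t, ∀ c ∈ Cube.boundary (Fin 1), Γ t c = x) :
    ∃ (a : GenLoop (Fin (n + 1)) X x) (p' : _), IsSphereLoopOf q a p' ∧
      GenLoop.Homotopic p p' := by
  have hqc := hq.continuous
  have hpc : Continuous ↿(fun (c : I^(Fin 1)) (y : I^(Fin n)) => p c (q y)) :=
    (ContinuousMap.continuous_uncurry_of_continuous p.1).comp
      (f := fun z : (I^(Fin 1)) × (I^(Fin n)) => (z.1, q z.2)) (by fun_prop)
  obtain ⟨L, hL, hL0, hLb, hLx⟩ := Cube.exists_homotopy_extension (x := x)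
    (fun (c : I^(Fin 1)) (y : I^(Fin n)) => p c (q y)) hpc Γ hΓ
    fun c y hy => by rw [h0, hz₀ y hy]
  have hLx' : ∀ t, ∀ c ∈ Cube.boundary (Fin 1), ∀ y, L t c y = x := fun t c hc y =>
    hLx c (fun y => by rw [GenLoop.boundary p c hc]; rfl) (fun t => hb t c hc) t y
  obtain ⟨G, hG⟩ := hq.exists_lift (T := I × (I^(Fin 1))) (fun z y => L z.1 z.2 y)
    (hL.comp (f := fun z : (I × (I^(Fin 1))) × (I^(Fin n)) => (z.1.1, z.1.2, z.2))
      (by fun_prop))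
    fun z y hy y' hy' => by rw [hLb _ _ _ hy, hLb _ _ _ hy']
  have hGb : ∀ t, ∀ c ∈ Cube.boundary (Fin 1), G (t, c) = ContinuousMap.const S x :=
    fun t c hc => ContinuousMap.ext fun z => by
      obtain ⟨y, rfl⟩ := hq.surjective z
      rw [hG]
      exact hLx' t c hc y
  refine ⟨⟨⟨fun w => L 1 (fun _ => w 0) (Fin.tail w), ?_⟩, fun w hw => ?_⟩,
    ⟨⟨fun c => G (1, c), by fun_prop⟩, hGb 1⟩, fun c y => ?_,
    GenLoop.homotopic_iff_exists.2 ⟨fun t c => G (t, c), G.continuous,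
      fun c => ContinuousMap.ext fun z => ?_, fun c => rfl, hGb⟩⟩
  · exact hL.comp (f := fun w : I^(Fin (n + 1)) => ((1 : I), (fun _ : Fin 1 => w 0), Fin.tail w))
      (Continuous.prodMk (by fun_prop) (Continuous.prodMk (by fun_prop)
        (continuous_pi fun i => by unfold Fin.tail; fun_prop)))
  · rcases Cube.mem_boundary_succ.1 hw with h | h
    · exact hLx' 1 _ (Cube.mem_boundary_fin_one.2 h) _
    · exact (hLb 1 _ _ h).trans (h1 _)
  · refine (hG _ _).trans ?_
    exact congrArg (fun c' => L 1 c' y) (funext fun i => congrArg c (Subsingleton.elim i 0))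
  · obtain ⟨y, rfl⟩ := hq.surjective z
    rw [hG, hL0]

end SphereLoops

/-- Postcomposition of generalized loops with a continuous map. -/
def GenLoop.map {X Y : Type*} [TopologicalSpace X] [TopologicalSpace Y] (f : C(X, Y)) {x : X}
    {N : Type*} (p : GenLoop N X x) : GenLoop N Y (f x) :=
  ⟨f.comp p.1, fun y hy => congrArg f (p.2 y hy)⟩

/-- If `f : X → Y` induces bijections `π₁(X, x) → π₁(Y, f x)` and
`π₁(C(Sⁿ, X), const_x) → π₁(C(Sⁿ, Y), const_{f x})` (the latter by postcomposition), then
it induces a bijection `π_{n+1}(X, x) → π_{n+1}(Y, f x)`. -/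
theorem bijective_pi_succ_of_bijective_pi_one
    {X Y : Type*} [TopologicalSpace X] [TopologicalSpace Y]
    (f : C(X, Y)) (x : X) (n : ℕ) (hn : 1 ≤ n)
    (h1 : Function.Bijective (HomotopyGroup.map f x (Fin 1)))
    (h2 : Function.Bijective
      (HomotopyGroup.map (spherePostcomp f n) (ContinuousMap.const _ x) (Fin 1))) :
    Function.Bijective (HomotopyGroup.map f x (Fin (n + 1))) := by
  obtain ⟨q, hq⟩ := exists_isBoundaryCollapse_sphere n hn
  have hmap : ∀ {a : GenLoop (Fin (n + 1)) X x} {p}, IsSphereLoopOf q a p →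
      IsSphereLoopOf q (GenLoop.map f a) (GenLoop.map (spherePostcomp f n) p) :=
    fun h c y => congrArg f (h c y)
  constructor
  · rintro ⟨a⟩ ⟨a'⟩ h
    obtain ⟨p, hp⟩ := hq.exists_isSphereLoopOf a
    obtain ⟨p', hp'⟩ := hq.exists_isSphereLoopOf a'
    have hpp' := IsSphereLoopOf.homotopic hq (hmap hp) (hmap hp') (Quotient.exact h)
    exact Quotient.sound (hp.homotopic_of_homotopic hn hq hp'
      (Quotient.exact (h2.injective (a₁ := ⟦p⟧) (a₂ := ⟦p'⟧) (Quotient.sound hpp'))))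
  · rintro ⟨a⟩
    obtain ⟨p, hp⟩ := hq.exists_isSphereLoopOf a
    obtain ⟨⟨b⟩, hb⟩ := h2.surjective ⟦p⟧
    have hbp : GenLoop.Homotopic (GenLoop.map (spherePostcomp f n) b) p := Quotient.exact hb
    have hy₀ : (0 : I^(Fin n)) ∈ Cube.boundary (Fin n) := ⟨⟨0, hn⟩, .inl rfl⟩
    let b₀ : GenLoop (Fin 1) X x :=
      ⟨⟨fun c => b c (q 0), (ContinuousEvalConst.continuous_eval_const (q 0)).comp b.1.continuous⟩,
        fun c hc => congrArg (fun g => g (q 0)) (b.2 c hc)⟩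
    have hev : GenLoop.Homotopic (GenLoop.map f b₀) (GenLoop.map f GenLoop.const) := by
      obtain ⟨F, hF, hF0, hF1, hFb⟩ := GenLoop.homotopic_iff_exists.1 hbp
      refine GenLoop.homotopic_iff_exists.2 ⟨fun t c => F t c (q 0),
        (ContinuousEvalConst.continuous_eval_const (q 0)).comp hF,
        fun c => congrArg (fun g => g (q 0)) (hF0 c), fun c => ?_,
        fun t c hc => congrArg (fun g => g (q 0)) (hFb t c hc)⟩
      refine (congrArg (fun g => g (q 0)) (hF1 c)).trans ((hp c 0).trans ?_)
      exact GenLoop.boundary a _ (Cube.cons_mem_boundary.2 (.inr hy₀))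
    have hb₀ : GenLoop.Homotopic b₀ GenLoop.const :=
      Quotient.exact (h1.injective (a₁ := ⟦b₀⟧) (a₂ := ⟦GenLoop.const⟧) (Quotient.sound hev))
    obtain ⟨Γ, hΓ, hΓ0, hΓ1, hΓb⟩ := GenLoop.homotopic_iff_exists.1 hb₀
    obtain ⟨a', p', hp', hbp'⟩ := hq.exists_isSphereLoopOf_homotopic (q 0)
      (fun y hy => hq.eq_of_mem y hy 0 hy₀) b Γ hΓ hΓ0 hΓ1 hΓb
    refine ⟨⟦a'⟧, Quotient.sound ((hmap hp').homotopic_of_homotopic hn hq hp ?_)⟩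
    refine GenLoop.Homotopic.trans ?_ hbp
    exact Nonempty.map (fun H => H.compContinuousMap (spherePostcomp f n)) hbp'.symm
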